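/- arXiv:2403.03540 — 2 statements merged into one kernel-verified Lean document; each statement's English description precedes it below -/
import Mathlib

section
/- Let (e₁,…,e_d) be an orthonormal basis of R^d, b ≤ d, and (g₁,…,g_b) a collection of orthonormal vectors in R^d with ‖eᵢ − gᵢ‖ ≤ ε for all i ∈ {1,…,b}. Then this collection can be completed to an orthonormal basis (g₁,…,g_d) of R^d satisfying ‖e_j − g_j‖ ≤ 2√b·ε for all j ∈ {1,…,d}. -/
lemma exists_close_isometry {V : Type*} [NormedAddCommGroup V] [InnerProductSpace ℝ V]
    [FiniteDimensional ℝ V] {b : ℕ} (g : Fin b → V) (hg : Orthonormal ℝ g)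
    (F : Submodule ℝ V) (c : ℝ) (hc : c < 1)
    (hF : ∀ x ∈ F, ∑ i, (inner ℝ (g i) x) ^ 2 ≤ c * ‖x‖ ^ 2) :
    ∃ U : F → V, (∀ x y, inner ℝ (U x) (U y) = inner ℝ x y) ∧
      (∀ i x, inner ℝ (g i) (U x) = 0) ∧ ∀ x, ‖U x - x‖ ^ 2 ≤ 2 * c * ‖x‖ ^ 2 := by
  classical
  let P : V →ₗ[ℝ] V := LinearMap.id - ∑ i, (innerₛₗ ℝ (g i)).smulRight (g i)
  have hP : ∀ x, P x = x - ∑ i, inner ℝ (g i) x • g i := by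
    intro x; simp [P, LinearMap.sum_apply]
  have hgP : ∀ i x, inner ℝ (g i) (P x) = 0 := by
    intro i x
    rw [hP, inner_sub_right, hg.inner_right_fintype, sub_self]
  have hPy : ∀ x y, inner ℝ (P x) y = inner ℝ x y - ∑ i, inner ℝ (g i) x * inner ℝ (g i) y := by
    intro x y
    rw [hP, inner_sub_left, sum_inner]
    simp [real_inner_smul_left]
  have hPsym : ∀ x y, inner ℝ (P x) y = inner ℝ x (P y) := by
    intro x y
    rw [hPy, ← real_inner_comm x (P y), hPy, real_inner_comm]
    simp [mul_comm]
  have hPP : ∀ x y, inner ℝ (P x) (P y) = inner ℝ (P x) y := by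
    intro x y
    rw [hP y, inner_sub_right, inner_sum]
    simp only [real_inner_smul_right, real_inner_comm (g _) (P x)]
    simp [real_inner_comm, hgP]
  let T : F →ₗ[ℝ] F := F.orthogonalProjectionOnto.toLinearMap ∘ₗ P ∘ₗ F.subtype
  have hT : ∀ x y : F, inner ℝ (T x) y = inner ℝ (P x) (y : V) := by
    intro x y
    simp [T]
  have hTs : T.IsSymmetric := by
    intro x y
    rw [hT, ← real_inner_comm x (T y), hT, hPsym, real_inner_comm]
  obtain ⟨n, hn⟩ : ∃ n, Module.finrank ℝ F = n := ⟨_, rfl⟩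
  let u := hTs.eigenvectorBasis hn
  let l := hTs.eigenvalues hn
  have hu : ∀ i, T (u i) = l i • u i := by
    intro i; exact hTs.apply_eigenvectorBasis hn i
  have hPu : ∀ i (x : F), inner ℝ (P (u i)) (x : V) = l i * inner ℝ (u i) x := by
    intro i x
    rw [← hT, hu, real_inner_smul_left]
  have hl : ∀ i, l i = 1 - ∑ k, (inner ℝ (g k) (u i : V)) ^ 2 := by
    intro i
    have h1 := hPu i (u i)
    rw [hPy] at h1
    have h2 : inner ℝ (u i) (u i) = (1 : ℝ) := by
      rw [real_inner_self_eq_norm_sq, u.orthonormal.1 i]; norm_num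
    have h3 : inner ℝ (u i : V) (u i : V) = (1 : ℝ) := h2
    rw [h2, h3] at h1
    simp only [pow_two]
    linarith
  have hl1 : ∀ i, l i ≤ 1 := by
    intro i
    rw [hl]
    have : 0 ≤ ∑ k, (inner ℝ (g k) (u i : V)) ^ 2 := by positivity
    linarith
  have hlc : ∀ i, 1 - c ≤ l i := by
    intro i
    have := hF (u i) (u i).2
    have h1 : ‖(u i : V)‖ = 1 := u.orthonormal.1 i
    rw [hl]
    rw [h1] at this
    linarith
  have hl0 : ∀ i, 0 < l i := fun i => by linarith [hlc i]
  have hs0 : ∀ i, 0 < √(l i) := fun i => Real.sqrt_pos.2 (hl0 i)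
  have hss : ∀ i, √(l i) * √(l i) = l i := fun i => Real.mul_self_sqrt (hl0 i).le
  have hs : ∀ i, 1 - c ≤ √(l i) := by
    intro i
    have := Real.sqrt_le_one.2 (hl1 i)
    nlinarith [hlc i, hs0 i, hss i]
  let v : Fin n → V := fun i => (√(l i))⁻¹ • P (u i)
  have hvx : ∀ i (x : F), inner ℝ (v i) (x : V) = √(l i) * inner ℝ (u i) x := by
    intro i x
    simp only [v]
    rw [real_inner_smul_left, hPu]
    nth_rewrite 2 [← hss i]
    have := (hs0 i).ne'
    field_simp
  have hv : Orthonormal ℝ v := by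
    rw [orthonormal_iff_ite]
    intro i j
    have h := orthonormal_iff_ite.1 u.orthonormal i j
    have : inner ℝ (v i) (v j) = (√(l j))⁻¹ * (√(l i) * inner ℝ (u i) (u j)) := by
      rw [← hvx]
      simp only [v]
      simp only [real_inner_smul_left, real_inner_smul_right]
      rw [hPP]
    rw [this, h]
    split_ifs with hij
    · subst hij
      have := (hs0 i).ne'
      field_simp
    · simp
  refine ⟨fun x => ∑ i, inner ℝ (u i) x • v i, ?_, ?_, ?_⟩
  · intro x y
    rw [hv.inner_sum, ← u.sum_inner_mul_inner x y]
    simp [real_inner_comm]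
  · intro k x
    rw [inner_sum]
    simp [v, real_inner_smul_right, hgP]
  · intro x
    have hx : ∑ i, (inner ℝ (u i) x) ^ 2 = ‖x‖ ^ 2 := by
      rw [← real_inner_self_eq_norm_sq, ← u.sum_inner_mul_inner x x]
      simp [real_inner_comm, pow_two]
    have h1 : ‖∑ i, inner ℝ (u i) x • v i‖ ^ 2 = ‖x‖ ^ 2 := by
      rw [← real_inner_self_eq_norm_sq, hv.inner_sum, ← hx]
      simp [pow_two]
    have h2 : inner ℝ (∑ i, inner ℝ (u i) x • v i) (x : V)
        = ∑ i, √(l i) * (inner ℝ (u i) x) ^ 2 := by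
      rw [sum_inner]
      refine Finset.sum_congr rfl fun i _ => ?_
      rw [real_inner_smul_left, hvx]; ring
    have h3 : (1 - c) * ‖x‖ ^ 2 ≤ ∑ i, √(l i) * (inner ℝ (u i) x) ^ 2 := by
      rw [← hx, Finset.mul_sum]
      exact Finset.sum_le_sum fun i _ => mul_le_mul_of_nonneg_right (hs i) (sq_nonneg _)
    have h4 : ‖(x : V)‖ = ‖x‖ := rfl
    rw [norm_sub_sq_real, h1, h2, h4]
    linarith

/-- if `(e₁,…,e_d)` is an orthonormal basis of `ℝ^d` and `(g₁,…,g_b)` are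
orthonormal vectors with `‖eᵢ − gᵢ‖ ≤ ε` for `i ≤ b`, then the collection can be
completed to an orthonormal basis `(g₁,…,g_d)` with `‖e_j − g_j‖ ≤ 2√b·ε` for all `j`. -/
theorem orthonormal_completion_close
    (d b : ℕ) (hbd : b ≤ d) (ε : ℝ) (hε : 0 ≤ ε)
    (e : OrthonormalBasis (Fin d) ℝ (EuclideanSpace ℝ (Fin d)))
    (g : Fin b → EuclideanSpace ℝ (Fin d)) (hg : Orthonormal ℝ g)
    (hclose : ∀ i : Fin b, ‖e (Fin.castLE hbd i) - g i‖ ≤ ε) :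
    ∃ g' : OrthonormalBasis (Fin d) ℝ (EuclideanSpace ℝ (Fin d)),
      (∀ i : Fin b, g' (Fin.castLE hbd i) = g i) ∧
      ∀ j : Fin d, ‖e j - g' j‖ ≤ 2 * Real.sqrt b * ε := by
  classical
  have hsq : (√(b : ℝ) * ε) ^ 2 = b * ε ^ 2 := by
    rw [mul_pow, Real.sq_sqrt (Nat.cast_nonneg b)]
  have hnn : 0 ≤ √(b : ℝ) * ε := by positivity
  rcases lt_or_ge (b * ε ^ 2) 1 with hc | hc
  · let F : Submodule ℝ (EuclideanSpace ℝ (Fin d)) :=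
      { carrier := {x | ∀ i : Fin b, inner ℝ (e (Fin.castLE hbd i)) x = 0}
        add_mem' := by
          intro x y hx hy i
          rw [inner_add_right, hx i, hy i, add_zero]
        zero_mem' := by intro i; simp
        smul_mem' := by
          intro a x hx i
          rw [real_inner_smul_right, hx i, mul_zero] }
    obtain ⟨U, hU1, hU2, hU3⟩ := exists_close_isometry g hg F (b * ε ^ 2) hc (by
      intro x hx
      have : ∀ i ∈ (Finset.univ : Finset (Fin b)), (inner ℝ (g i) x) ^ 2 ≤ ε ^ 2 * ‖x‖ ^ 2 := by
        intro i _
        have h1 : inner ℝ (e (Fin.castLE hbd i) - g i) x = - inner ℝ (g i) x := by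
          rw [inner_sub_left, hx i, zero_sub]
        have h2 := abs_real_inner_le_norm (e (Fin.castLE hbd i) - g i) x
        rw [h1, abs_neg] at h2
        have h3 := h2.trans (mul_le_mul_of_nonneg_right (hclose i) (norm_nonneg x))
        rw [← sq_abs, ← mul_pow]
        exact pow_le_pow_left₀ (abs_nonneg _) h3 2
      refine (Finset.sum_le_sum this).trans ?_
      simp [mul_assoc])
    have heF : ∀ j : Fin d, ¬ (j : ℕ) < b → e j ∈ F := by
      intro j hj i
      apply e.orthonormal.2
      rintro rfl
      exact hj i.2
    let w : Fin d → EuclideanSpace ℝ (Fin d) := fun j =>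
      if h : (j : ℕ) < b then g ⟨j, h⟩ else U ⟨e j, heF j h⟩
    have hw : Orthonormal ℝ w := by
      rw [orthonormal_iff_ite]
      intro i j
      by_cases hi : (i : ℕ) < b <;> by_cases hj : (j : ℕ) < b
      · simp only [w, hi, hj, dif_pos]
        rw [orthonormal_iff_ite.1 hg]
        simp [Fin.ext_iff]
      · simp only [w, hi, hj, dif_pos, dif_neg, not_false_eq_true]
        rw [hU2, if_neg]
        rintro rfl; exact hj hi
      · simp only [w, hi, hj, dif_pos, dif_neg, not_false_eq_true]
        rw [real_inner_comm, hU2, if_neg]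
        rintro rfl; exact hi hj
      · simp only [w, hi, hj, dif_neg, not_false_eq_true]
        rw [hU1]
        exact orthonormal_iff_ite.1 e.orthonormal i j
    obtain ⟨g', hg'⟩ := Orthonormal.exists_orthonormalBasis_extension_of_card_eq
      (𝕜 := ℝ) (ι := Fin d) (v := w) (s := Set.univ) (by simp)
      (hw.comp _ Subtype.val_injective)
    refine ⟨g', fun i => ?_, fun j => ?_⟩
    · rw [hg' _ (Set.mem_univ _)]
      simp [w]
    · rw [hg' _ (Set.mem_univ _)]
      by_cases hj : (j : ℕ) < b
      · simp only [w, hj, dif_pos]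
        have h1 := hclose ⟨j, hj⟩
        have h2 : (1 : ℝ) ≤ √(b : ℝ) := by
          rw [Real.one_le_sqrt]
          exact_mod_cast (by omega : 1 ≤ b)
        have h3 : Fin.castLE hbd ⟨j, hj⟩ = j := rfl
        rw [h3] at h1
        nlinarith
      · simp only [w, hj, dif_neg, not_false_eq_true]
        have h1 := hU3 ⟨e j, heF j hj⟩
        have h2 : ‖(⟨e j, heF j hj⟩ : F)‖ = 1 := e.orthonormal.1 j
        rw [h2, norm_sub_rev] at h1
        apply le_of_sq_le_sq _ (by positivity)
        dsimp only at h1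
        nlinarith
  · let w : Fin d → EuclideanSpace ℝ (Fin d) := fun j =>
      if h : (j : ℕ) < b then g ⟨j, h⟩ else 0
    obtain ⟨g', hg'⟩ := Orthonormal.exists_orthonormalBasis_extension_of_card_eq
      (𝕜 := ℝ) (ι := Fin d) (v := w) (s := {j | (j : ℕ) < b}) (by simp) (by
        have : Set.domRestrict {j : Fin d | (j : ℕ) < b} w
            = g ∘ fun j : {j : Fin d | (j : ℕ) < b} => (⟨j.1, j.2⟩ : Fin b) := by
          funext j
          have hj : ((j : Fin d) : ℕ) < b := j.2
          simp [w, hj]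
        rw [this]
        apply hg.comp
        intro x y h
        simpa [Fin.ext_iff, Subtype.ext_iff] using h)
    refine ⟨g', fun i => ?_, fun j => ?_⟩
    · rw [hg' _ (by simp)]
      simp [w]
    · have h1 := norm_sub_le (e j) (g' j)
      rw [e.orthonormal.1 j, g'.orthonormal.1 j] at h1
      have : 1 ≤ √(b : ℝ) * ε := by nlinarith
      linarith
end

section
/- For every x > −1/2, the ratio of Gamma functions satisfies √(x + 1/4) < Γ(x+1)/Γ(x+1/2) < √(x + 1/2). -/
theorem aux_mid (s : ℝ) (hs : 0 < s) :
    Real.Gamma (s + 1/2) ^ 2 ≤ s * Real.Gamma s ^ 2 := by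
  have h := Real.Gamma_mul_add_mul_le_rpow_Gamma_mul_rpow_Gamma hs
    (show (0:ℝ) < s + 1 by linarith) (show (0:ℝ) < 1/2 by norm_num)
    (show (0:ℝ) < 1/2 by norm_num) (by norm_num)
  have e : 1/2 * s + 1/2 * (s + 1) = s + 1/2 := by ring
  have h1 := Real.Gamma_pos_of_pos hs
  have h2 : 0 < Real.Gamma (s + 1) := Real.Gamma_pos_of_pos (by linarith)
  have h3 : 0 < Real.Gamma (s + 1/2) := Real.Gamma_pos_of_pos (by linarith)
  rw [e, ← Real.sqrt_eq_rpow, ← Real.sqrt_eq_rpow] at h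
  calc Real.Gamma (s + 1/2) ^ 2
      ≤ (√(Real.Gamma s) * √(Real.Gamma (s + 1))) ^ 2 := by gcongr
    _ = Real.Gamma s * Real.Gamma (s + 1) := by
        rw [mul_pow, Real.sq_sqrt h1.le, Real.sq_sqrt h2.le]
    _ = s * Real.Gamma s ^ 2 := by
        rw [Real.Gamma_add_one hs.ne']; ring

/-- The squared ratio. -/
noncomputable def ratSq (x : ℝ) : ℝ := (Real.Gamma (x + 1) / Real.Gamma (x + 1/2)) ^ 2

theorem ratSq_pos (x : ℝ) (hx : -1/2 < x) : 0 < ratSq x := by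
  have h2 : 0 < Real.Gamma (x + 1) := Real.Gamma_pos_of_pos (by linarith)
  have h3 : 0 < Real.Gamma (x + 1/2) := Real.Gamma_pos_of_pos (by linarith)
  unfold ratSq; positivity

theorem ratSq_succ (x : ℝ) (hx : -1/2 < x) :
    ratSq (x + 1) * (x + 1/2) ^ 2 = ratSq x * (x + 1) ^ 2 := by
  have h3 : 0 < Real.Gamma (x + 1/2) := Real.Gamma_pos_of_pos (by linarith)
  have h4 : 0 < x + 1/2 := by linarith
  have h5 : 0 < x + 1 := by linarith
  unfold ratSq
  rw [show x + 1 + 1/2 = (x + 1/2) + 1 by ring, Real.Gamma_add_one h4.ne',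
    Real.Gamma_add_one h5.ne']
  generalize Real.Gamma (x + 1/2) = G at *
  generalize x + 1/2 = y at *
  field_simp

theorem ratSq_le (x : ℝ) (hx : -1/2 < x) : ratSq x ≤ x + 1/2 := by
  have h3 : 0 < Real.Gamma (x + 1/2) := Real.Gamma_pos_of_pos (by linarith)
  have h := aux_mid (x + 1/2) (by linarith)
  rw [show x + 1/2 + 1/2 = x + 1 by ring] at h
  unfold ratSq
  rw [div_pow, div_le_iff₀ (by positivity)]
  exact h

theorem le_ratSq (x : ℝ) (hx : 0 < x) : x ≤ ratSq x := by
  have h3 : 0 < Real.Gamma (x + 1/2) := Real.Gamma_pos_of_pos (by linarith)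
  have h := aux_mid x hx
  unfold ratSq
  rw [div_pow, le_div_iff₀ (by positivity), Real.Gamma_add_one hx.ne']
  nlinarith

theorem ratSq_lt (x : ℝ) (hx : -1/2 < x) : ratSq x < x + 1/2 := by
  have h := ratSq_le (x + 1) (by linarith)
  have e := ratSq_succ x hx
  have h4 : 0 < x + 1/2 := by linarith
  have h6 : ratSq x * (x + 1) ^ 2 ≤ (x + 1 + 1/2) * (x + 1/2) ^ 2 := by
    rw [← e]; gcongr
  by_contra hc
  push Not at hc
  have h7 : (x + 1/2) * (x + 1) ^ 2 ≤ ratSq x * (x + 1) ^ 2 := by gcongr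
  nlinarith

theorem ratSq_step (x : ℝ) (hx : -1/4 < x) :
    ratSq (x + 1) * (x + 1/4) < ratSq x * (x + 1 + 1/4) := by
  have e := ratSq_succ x (by linarith)
  have h4 : 0 < (x + 1/2) ^ 2 := by have : 0 < x + 1/2 := by linarith
                                    positivity
  have hp := ratSq_pos x (by linarith)
  refine lt_of_mul_lt_mul_right ?_ h4.le
  have : ratSq (x + 1) * (x + 1/4) * (x + 1/2) ^ 2 = ratSq x * ((x + 1) ^ 2 * (x + 1/4)) := by
    linear_combination (x + 1/4) * e
  rw [this, mul_assoc]
  refine mul_lt_mul_of_pos_left ?_ hp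
  nlinarith

theorem ratSq_iter (n : ℕ) (x : ℝ) (hx : -1/4 < x) :
    ratSq (x + n) * (x + 1/4) ≤ ratSq x * (x + n + 1/4) := by
  induction n with
  | zero => simp
  | succ n ih =>
    have hn : (0:ℝ) ≤ n := n.cast_nonneg
    have h := (ratSq_step (x + n) (by linarith)).le
    push_cast
    rw [← add_assoc]
    have hp : 0 < x + n + 1/4 := by linarith
    have hq : 0 < x + 1/4 := by linarith
    refine le_of_mul_le_mul_right ?_ hp
    have h1 := mul_le_mul_of_nonneg_right h hq.le
    have h2 := mul_le_mul_of_nonneg_right ih (show 0 ≤ x + n + 1 + 1/4 by linarith)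
    nlinarith

theorem ratSq_ge (x : ℝ) (hx : 0 < x) : x + 1/4 ≤ ratSq x := by
  by_contra hc
  push Not at hc
  obtain ⟨n, hn⟩ := exists_nat_gt (ratSq x / (x + 1/4 - ratSq x))
  have hd : 0 < x + 1/4 - ratSq x := by linarith
  rw [div_lt_iff₀ hd] at hn
  have hn0 : (0:ℝ) ≤ n := n.cast_nonneg
  have h1 := ratSq_iter n x (by linarith)
  have h2 := le_ratSq (x + n) (by linarith)
  have h3 : (x + n) * (x + 1/4) ≤ ratSq (x + n) * (x + 1/4) := by gcongr
  have h4 := ratSq_pos x (by linarith)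
  nlinarith [mul_pos hx hd]

theorem lt_ratSq (x : ℝ) (hx : -1/4 < x) : x + 1/4 < ratSq x := by
  have h := ratSq_ge (x + 1) (by linarith)
  have h1 := ratSq_step x hx
  have hq : 0 < x + 1/4 := by linarith
  have h2 := mul_le_mul_of_nonneg_right h hq.le
  have h3 : 0 < x + 1 + 1/4 := by linarith
  refine lt_of_mul_lt_mul_right ?_ h3.le
  linarith

/-- for every `x > −1/2`, `√(x + 1/4) < Γ(x+1)/Γ(x+1/2) < √(x + 1/2)`. -/
theorem gamma_ratio_sqrt_bounds (x : ℝ) (hx : -1/2 < x) :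
    Real.sqrt (x + 1/4) < Real.Gamma (x + 1) / Real.Gamma (x + 1/2) ∧
    Real.Gamma (x + 1) / Real.Gamma (x + 1/2) < Real.sqrt (x + 1/2) := by
  have h2 : 0 < Real.Gamma (x + 1) := Real.Gamma_pos_of_pos (by linarith)
  have h3 : 0 < Real.Gamma (x + 1/2) := Real.Gamma_pos_of_pos (by linarith)
  have h4 : 0 < Real.Gamma (x + 1) / Real.Gamma (x + 1/2) := by positivity
  constructor
  · rw [Real.sqrt_lt' h4]
    rcases lt_or_ge (-1/4) x with h | h
    · exact lt_ratSq x h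
    · have : x + 1/4 ≤ 0 := by linarith
      exact this.trans_lt (by positivity)
  · exact Real.lt_sqrt_of_sq_lt (ratSq_lt x hx)
end
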